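/- arXiv:1509.00917 — 3 statements merged into one kernel-verified Lean document; each statement's English description precedes it below -/
import Mathlib

section
/- Asymptotic stability of the degenerately damped oscillator: let k > 0, α > 0 and let m ≥ 1 be an integer. If x : [0,∞) → ℝ is twice continuously differentiable and satisfies x''(t) + k x(t) + α x(t)^(2m) x'(t) = 0 for all t ≥ 0, then x(t) → 0 and x'(t) → 0 as t → ∞. -/
open Filter

/-- A form of Barbalat's lemma: a convergent function with bounded second derivative has a
derivative tending to `0`. -/
theorem tendsto_deriv_zero_of_tendsto_of_bounded {f f' f'' : ℝ → ℝ} {L C : ℝ}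
    (hf : ∀ t, 0 ≤ t → HasDerivAt f (f' t) t) (hf' : ∀ t, 0 ≤ t → HasDerivAt f' (f'' t) t)
    (hC : ∀ t, 0 ≤ t → |f'' t| ≤ C) (hL : Tendsto f atTop (nhds L)) :
    Tendsto f' atTop (nhds 0) := by
  have hC0 : 0 ≤ C := (abs_nonneg _).trans (hC 0 le_rfl)
  rw [Metric.tendsto_atTop]
  intro ε hε
  obtain ⟨h, hh, hCh⟩ : ∃ h : ℝ, 0 < h ∧ C * h < ε / 2 := by
    refine ⟨ε / (2 * (C + 1)), by positivity, ?_⟩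
    rw [mul_div_assoc', div_lt_div_iff₀ (by positivity) (by positivity)]
    nlinarith
  have hdiff : Tendsto (fun t => f (t + h) - f t) atTop (nhds 0) := by
    simpa using (hL.comp (tendsto_atTop_add_const_right _ h tendsto_id)).sub hL
  obtain ⟨N, hN⟩ := Metric.tendsto_atTop.1 hdiff (h * (ε / 2)) (by positivity)
  refine ⟨max N 0, fun t ht => ?_⟩
  have ht0 : 0 ≤ t := (le_max_right _ _).trans ht
  have hNt := hN t ((le_max_left _ _).trans ht)
  rw [Real.dist_eq, sub_zero] at hNt ⊢
  obtain ⟨c, hc, hfc⟩ := exists_hasDerivAt_eq_slope f f' (show t < t + h by linarith)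
    (fun s hs => (hf s (ht0.trans hs.1)).continuousAt.continuousWithinAt)
    (fun s hs => hf s (ht0.trans hs.1.le))
  obtain ⟨d, hd, hfd⟩ := exists_hasDerivAt_eq_slope f' f'' hc.1
    (fun s hs => (hf' s (ht0.trans hs.1)).continuousAt.continuousWithinAt)
    (fun s hs => hf' s (ht0.trans hs.1.le))
  have hct : 0 < c - t := sub_pos.2 hc.1
  have hslope : |f' c| < ε / 2 := by
    rw [hfc, add_sub_cancel_left, abs_div, abs_of_pos hh, div_lt_iff₀ hh]
    linarith
  have hvar : |f' c - f' t| ≤ C * h := by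
    rw [eq_div_iff hct.ne'] at hfd
    rw [← hfd, abs_mul, abs_of_pos hct]
    exact mul_le_mul (hC d (ht0.trans hd.1.le)) (by linarith [hc.2]) hct.le hC0
  rw [abs_lt] at hslope ⊢
  rw [abs_le] at hvar
  constructor <;> linarith

/-- A function that is antitone on `[0, ∞)` and bounded below there converges. -/
theorem AntitoneOn.exists_tendsto_atTop {V : ℝ → ℝ} {b : ℝ} (hV : AntitoneOn V (Set.Ici 0))
    (hb : ∀ t, 0 ≤ t → b ≤ V t) : ∃ L, Tendsto V atTop (nhds L) := by
  have hanti : Antitone fun t => V (max t 0) := fun s t hst =>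
    hV (Set.mem_Ici.2 (le_max_right _ _)) (Set.mem_Ici.2 (le_max_right _ _)) (max_le_max_right 0 hst)
  have hbdd : BddBelow (Set.range fun t => V (max t 0)) :=
    ⟨b, by rintro _ ⟨t, rfl⟩; exact hb _ (le_max_right _ _)⟩
  refine ⟨_, (tendsto_atTop_ciInf hanti hbdd).congr' ?_⟩
  filter_upwards [eventually_ge_atTop 0] with t ht
  rw [max_eq_left ht]

/-- Asymptotic stability of the degenerately damped harmonic oscillator
`x'' + kx + αx^(2m)x' = 0`: every solution and its velocity tend to `0`. -/
theorem oscillator_asymptotic_stability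
    (k α : ℝ) (hk : 0 < k) (hα : 0 < α) (m : ℕ) (hm : 1 ≤ m)
    (x : ℝ → ℝ) (hx : ContDiff ℝ 2 x)
    (hode : ∀ t : ℝ, 0 ≤ t →
      deriv (deriv x) t + k * x t + α * (x t) ^ (2*m) * deriv x t = 0) :
    Tendsto x atTop (nhds 0) ∧ Tendsto (deriv x) atTop (nhds 0) := by
  have hdx : ∀ t, HasDerivAt x (deriv x t) t := fun t =>
    (hx.differentiable (by norm_num) t).hasDerivAt
  have hv : ContDiff ℝ 1 (deriv x) := by
    have h2 : ContDiff ℝ (1 + 1) x := by simpa [one_add_one_eq_two] using hx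
    exact (contDiff_succ_iff_deriv.1 h2).2.2
  generalize deriv x = v at *
  have hdv : ∀ t, 0 ≤ t → HasDerivAt v (-(k * x t + α * x t ^ (2*m) * v t)) t := fun t ht => by
    refine (hv.differentiable (by norm_num) t).hasDerivAt.congr_deriv ?_
    linarith [hode t ht]
  have hdV : ∀ t, 0 ≤ t → HasDerivAt (fun t => k * x t ^ 2 + v t ^ 2)
      (-2 * α * (x t ^ (2*m) * v t ^ 2)) t := fun t ht => by
    refine ((((hdx t).pow 2).const_mul k).add ((hdv t ht).pow 2)).congr_deriv ?_
    push_cast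
    ring
  have hanti : AntitoneOn (fun t => k * x t ^ 2 + v t ^ 2) (Set.Ici 0) := by
    refine antitoneOn_of_hasDerivWithinAt_nonpos (convex_Ici 0)
      (fun t ht => (hdV t ht).continuousAt.continuousWithinAt)
      (fun t ht => (hdV t (interior_subset ht)).hasDerivWithinAt) fun t _ => ?_
    have : 0 ≤ α * (x t ^ (2*m) * v t ^ 2) := by
      rw [pow_mul]; positivity
    linarith
  obtain ⟨L, hL⟩ := hanti.exists_tendsto_atTop (b := 0) fun t _ => by positivity
  obtain ⟨B, hB⟩ : ∃ B : ℝ, ∀ t, 0 ≤ t → |x t| ≤ B ∧ |v t| ≤ B := by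
    set E := k * x 0 ^ 2 + v 0 ^ 2
    have hE : 0 ≤ E := by positivity
    refine ⟨√(E / k) + √E, fun t ht => ?_⟩
    have hle : k * x t ^ 2 + v t ^ 2 ≤ E := hanti Set.self_mem_Ici ht ht
    have hx2 : |x t| ≤ √(E / k) := Real.abs_le_sqrt (by
      rw [le_div_iff₀ hk]; nlinarith [sq_nonneg (v t)])
    have hv2 : |v t| ≤ √E := Real.abs_le_sqrt (by
      nlinarith [mul_nonneg hk.le (sq_nonneg (x t))])
    constructor <;> linarith [Real.sqrt_nonneg E, Real.sqrt_nonneg (E / k)]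
  have hbound : ∀ F : ℝ × ℝ → ℝ, Continuous F → ∃ C, ∀ t, 0 ≤ t → |F (x t, v t)| ≤ C := by
    intro F hF
    obtain ⟨C, hC⟩ := ((isCompact_Icc (a := -B) (b := B)).prod
      (isCompact_Icc (a := -B) (b := B))).exists_bound_of_continuousOn hF.continuousOn
    exact ⟨C, fun t ht => hC _ ⟨abs_le.1 (hB t ht).1, abs_le.1 (hB t ht).2⟩⟩
  have hdiss : Tendsto (fun t => x t ^ (2*m) * v t ^ 2) atTop (nhds 0) := by
    obtain ⟨C, hC⟩ := hbound (fun p => -2 * α * ((2*m : ℕ) * p.1 ^ (2*m-1) * p.2 * p.2 ^ 2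
      + p.1 ^ (2*m) * ((2 : ℕ) * p.2 ^ (2-1) * -(k * p.1 + α * p.1 ^ (2*m) * p.2))))
      (by fun_prop)
    have h := tendsto_deriv_zero_of_tendsto_of_bounded hdV
      (fun t ht => (((hdx t).pow (2*m)).mul ((hdv t ht).pow 2)).const_mul (-2 * α)) hC hL
    have hα' : -2 * α ≠ 0 := by simp [hα.ne']
    simpa only [inv_mul_cancel_left₀ hα', mul_zero] using h.const_mul (-2 * α)⁻¹
  have hxv : Tendsto (fun t => x t * v t) atTop (nhds 0) := by
    obtain ⟨C, hC⟩ := hbound (fun p => p.2 ^ (2*m-2)) (by fun_prop)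
    have hpow : Tendsto (fun t => (x t * v t) ^ (2*m)) atTop (nhds 0) := by
      refine squeeze_zero_norm' (a := fun t => C * (x t ^ (2*m) * v t ^ 2)) ?_
        (by simpa using hdiss.const_mul C)
      filter_upwards [eventually_ge_atTop 0] with t ht
      have hsplit : (x t * v t) ^ (2*m) = v t ^ (2*m-2) * (x t ^ (2*m) * v t ^ 2) := by
        obtain ⟨n, rfl⟩ := Nat.exists_eq_add_of_le' hm
        rw [show 2 * (n + 1) - 2 = 2 * n by omega]
        ring
      have hnn : 0 ≤ x t ^ (2*m) * v t ^ 2 := by rw [pow_mul]; positivity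
      rw [hsplit, norm_mul, Real.norm_of_nonneg hnn]
      exact mul_le_mul_of_nonneg_right (hC t ht) hnn
    rw [tendsto_zero_iff_abs_tendsto_zero]
    have hroot := hpow.abs.rpow_const (p := ((2*m : ℕ) : ℝ)⁻¹) (Or.inr (by positivity))
    rw [abs_zero, Real.zero_rpow (by positivity)] at hroot
    refine hroot.congr fun t => ?_
    rw [abs_pow, Real.pow_rpow_inv_natCast (abs_nonneg _) (by omega)]
    rfl
  have hgap : Tendsto (fun t => v t ^ 2 - k * x t ^ 2 - α * (x t ^ (2*m+1) * v t))
      atTop (nhds 0) := by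
    obtain ⟨C, hC⟩ := hbound (fun p => (2 : ℕ) * p.2 ^ (2-1) * -(k * p.1 + α * p.1 ^ (2*m) * p.2)
      - k * ((2 : ℕ) * p.1 ^ (2-1) * p.2)
      - α * ((2*m+1 : ℕ) * p.1 ^ (2*m+1-1) * p.2 * p.2
        + p.1 ^ (2*m+1) * -(k * p.1 + α * p.1 ^ (2*m) * p.2))) (by fun_prop)
    refine tendsto_deriv_zero_of_tendsto_of_bounded
      (fun t ht => ((hdx t).mul (hdv t ht)).congr_deriv ?_)
      (fun t ht => (((hdv t ht).pow 2).sub (((hdx t).pow 2).const_mul k)).sub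
        ((((hdx t).pow (2*m+1)).mul (hdv t ht)).const_mul α)) hC hxv
    ring
  have hdamp : Tendsto (fun t => x t ^ (2*m) * (x t * v t)) atTop (nhds 0) := by
    obtain ⟨C, hC⟩ := hbound (fun p => p.1 ^ (2*m)) (by fun_prop)
    refine squeeze_zero_norm' (a := fun t => C * |x t * v t|) ?_
      (by simpa using hxv.abs.const_mul C)
    filter_upwards [eventually_ge_atTop 0] with t ht
    rw [norm_mul]
    exact mul_le_mul_of_nonneg_right (hC t ht) (abs_nonneg _)
  have hV : Tendsto (fun t => k * x t ^ 2 + v t ^ 2) atTop (nhds 0) := by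
    have hsq : Tendsto (fun t => (k * x t ^ 2 + v t ^ 2) ^ 2) atTop (nhds 0) := by
      have h := ((hgap.add (hdamp.const_mul α)).pow 2).add ((hxv.pow 2).const_mul (4 * k))
      simp only [mul_zero, add_zero, ne_eq, OfNat.ofNat_ne_zero, not_false_eq_true, zero_pow] at h
      exact h.congr fun t => by ring
    have h := hsq.sqrt
    rw [Real.sqrt_zero] at h
    exact h.congr fun t => Real.sqrt_sq (by positivity)
  have hsqrt_zero : ∀ y : ℝ → ℝ, Tendsto (fun t => y t ^ 2) atTop (nhds 0) →
      Tendsto y atTop (nhds 0) := fun y hy => by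
    rw [tendsto_zero_iff_abs_tendsto_zero]
    have h := hy.sqrt
    rw [Real.sqrt_zero] at h
    exact h.congr fun t => Real.sqrt_sq_eq_abs _
  constructor
  · refine hsqrt_zero x (squeeze_zero (fun t => sq_nonneg _) (fun t => ?_)
      (by simpa using hV.const_mul k⁻¹))
    rw [mul_add, inv_mul_cancel_left₀ hk.ne']
    exact le_add_of_nonneg_right (by positivity)
  · exact hsqrt_zero v (squeeze_zero (fun t => sq_nonneg _)
      (fun t => le_add_of_nonneg_left (by positivity)) hV)
end

section
/- Uniform stability of the degenerately damped oscillator: let k > 0, α > 0 and let m ≥ 1 be an integer. For every R > 0 and every ε > 0 there exists T > 0 such that every twice continuously differentiable x : [0,∞) → ℝ satisfying x''(t) + k x(t) + α x(t)^(2m) x'(t) = 0 for all t ≥ 0 and (1/2)k x(0)² + (1/2)x'(0)² ≤ R also satisfies (1/2)k x(t)² + (1/2)x'(t)² < ε for all t ≥ T. -/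
/-- On a compact set, a function that is negative where `f ≥ 0` vanishes becomes uniformly
negative after subtracting a large multiple of `f`. -/
lemma IsCompact.exists_sub_nat_mul_lt {X : Type*} [TopologicalSpace X] {K : Set X}
    (hK : IsCompact K) {f g : X → ℝ} (hf : Continuous f) (hg : Continuous g)
    (hf0 : ∀ p, 0 ≤ f p) (hfg : ∀ p ∈ K, f p = 0 → g p < 0) :
    ∃ n : ℕ, ∀ p ∈ K, g p - n * f p < -(1 / ((n : ℝ) + 1)) := by
  refine hK.elim_directed_cover (fun n : ℕ => {p | g p - n * f p < -(1 / ((n : ℝ) + 1))})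
    (fun n => isOpen_lt (by fun_prop) (by fun_prop)) ?_ ?_
  · intro p hp
    simp only [Set.mem_iUnion, Set.mem_ofPred_eq]
    rcases (hf0 p).eq_or_lt with h | h
    · have hneg := hfg p hp h.symm
      obtain ⟨n, hn⟩ := exists_nat_one_div_lt (neg_pos.mpr hneg)
      exact ⟨n, by rw [← h]; linarith⟩
    · obtain ⟨n, hn⟩ := exists_nat_gt ((g p + 1) / f p)
      refine ⟨n, ?_⟩
      rw [div_lt_iff₀ h] at hn
      have : 1 / ((n : ℝ) + 1) ≤ 1 := by
        rw [div_le_one (by positivity)]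
        linarith [n.cast_nonneg (α := ℝ)]
      linarith
  · refine Monotone.directed_le fun a b hab p hp => ?_
    simp only [Set.mem_ofPred_eq] at hp ⊢
    have h1 : (a : ℝ) ≤ b := by exact_mod_cast hab
    have h2 := one_div_le_one_div_of_le (by positivity : (0 : ℝ) < a + 1)
      (by linarith : (a : ℝ) + 1 ≤ b + 1)
    have h3 := mul_le_mul_of_nonneg_right h1 (hf0 p)
    linarith

/-- The closed region between two energy levels of the harmonic oscillator is compact. -/
lemma isCompact_oscillator_energy_shell {k : ℝ} (hk : 0 < k) (ε R : ℝ) :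
    IsCompact {p : ℝ × ℝ | ε ≤ (1/2) * k * p.1^2 + (1/2) * p.2^2 ∧
      (1/2) * k * p.1^2 + (1/2) * p.2^2 ≤ R} := by
  refine (isCompact_Icc (a := ((-(2 * R / k + 1), -(2 * R + 1)) : ℝ × ℝ))
    (b := (2 * R / k + 1, 2 * R + 1))).of_isClosed_subset ?_ ?_
  · have hV : Continuous fun p : ℝ × ℝ => (1/2) * k * p.1^2 + (1/2) * p.2^2 := by fun_prop
    exact (isClosed_le continuous_const hV).inter (isClosed_le hV continuous_const)
  · rintro ⟨a, b⟩ ⟨-, h⟩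
    simp only at h
    have ha : a ^ 2 ≤ 2 * R / k := by
      rw [le_div_iff₀ hk]
      nlinarith [sq_nonneg b]
    have hb : b ^ 2 ≤ 2 * R := by nlinarith [mul_nonneg hk.le (sq_nonneg a)]
    rw [Set.mem_Icc, Prod.mk_le_mk, Prod.mk_le_mk]
    refine ⟨⟨?_, ?_⟩, ?_, ?_⟩ <;>
      nlinarith [sq_nonneg (a - 1), sq_nonneg (a + 1), sq_nonneg (b - 1), sq_nonneg (b + 1)]

/-- Uniform stability of the degenerately damped harmonic oscillator: the time to reach
energy level `ε` depends only on the initial energy bound `R`. -/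
theorem oscillator_uniform_stability
    (k α : ℝ) (hk : 0 < k) (hα : 0 < α) (m : ℕ) (hm : 1 ≤ m) :
    ∀ R > (0:ℝ), ∀ ε > (0:ℝ), ∃ T > (0:ℝ), ∀ x : ℝ → ℝ,
      ContDiff ℝ 2 x →
      (∀ t : ℝ, 0 ≤ t →
        deriv (deriv x) t + k * x t + α * (x t) ^ (2*m) * deriv x t = 0) →
      (1/2) * k * (x 0)^2 + (1/2) * (deriv x 0)^2 ≤ R →
      ∀ t : ℝ, T ≤ t → (1/2) * k * (x t)^2 + (1/2) * (deriv x t)^2 < ε := by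
  intro R _ ε hε
  have hK := isCompact_oscillator_energy_shell hk ε R
  set K := {p : ℝ × ℝ | ε ≤ (1/2) * k * p.1^2 + (1/2) * p.2^2 ∧
      (1/2) * k * p.1^2 + (1/2) * p.2^2 ≤ R}
  have hpow (a : ℝ) : 0 ≤ a ^ (2 * m) := (even_two_mul m).pow_nonneg a
  -- The cross term `x³y - xy³` decreases strictly along the flow wherever the damping vanishes.
  obtain ⟨n, hn⟩ := hK.exists_sub_nat_mul_lt
    (f := fun p => α * p.1 ^ (2 * m) * p.2 ^ 2)
    (g := fun p => (3 * p.1 ^ 2 * p.2 - p.2 ^ 3) * p.2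
      - (p.1 ^ 3 - 3 * p.1 * p.2 ^ 2) * (k * p.1 + α * p.1 ^ (2 * m) * p.2))
    (by fun_prop) (by fun_prop)
    (fun p => mul_nonneg (mul_nonneg hα.le (hpow _)) (sq_nonneg _)) (by
      rintro ⟨a, b⟩ ⟨h, -⟩ hf
      simp only at h hf ⊢
      rcases mul_eq_zero.mp hf with h0 | h0
      · have ha : a = 0 := eq_zero_of_pow_eq_zero ((mul_eq_zero.mp h0).resolve_left hα.ne')
        subst ha
        have hb : b ≠ 0 := by
          rintro rfl
          norm_num at h
          linarith
        have : 0 < b ^ 4 := by positivity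
        nlinarith
      · have hb : b = 0 := eq_zero_of_pow_eq_zero h0
        subst hb
        have ha : a ≠ 0 := by
          rintro rfl
          norm_num at h
          linarith
        have : 0 < k * a ^ 4 := by positivity
        nlinarith)
  obtain ⟨M, hM⟩ := hK.exists_bound_of_continuousOn
    (f := fun p : ℝ × ℝ => n * ((1/2) * k * p.1^2 + (1/2) * p.2^2)
      + (p.1 ^ 3 * p.2 - p.1 * p.2 ^ 3)) (by fun_prop)
  set δ : ℝ := 1 / ((n : ℝ) + 1)
  have hδ : 0 < δ := by positivity
  refine ⟨2 * |M| / δ + 1, by positivity, ?_⟩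
  intro x hx hode hinit t ht
  by_contra! hlt
  have ht0 : 0 ≤ t := le_trans (by positivity) ht
  have hx' (s : ℝ) : HasDerivAt x (deriv x s) s :=
    (hx.differentiable (by norm_num) s).hasDerivAt
  have hy' (s : ℝ) : HasDerivAt (deriv x) (deriv (deriv x) s) s :=
    ((hx.deriv' (n := 1)).differentiable (by norm_num) s).hasDerivAt
  have hE (s : ℝ) (hs : 0 ≤ s) :
      HasDerivAt (fun s => (1/2) * k * (x s)^2 + (1/2) * (deriv x s)^2)
        (-(α * (x s) ^ (2 * m) * (deriv x s) ^ 2)) s := by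
    refine ((((hx' s).pow 2).const_mul ((1/2) * k)).add
      (((hy' s).pow 2).const_mul (1/2))).congr_deriv ?_
    push_cast
    linear_combination (deriv x s) * hode s hs
  have hG (s : ℝ) (hs : 0 ≤ s) :
      HasDerivAt (fun s => (x s) ^ 3 * deriv x s - x s * (deriv x s) ^ 3)
        ((3 * (x s) ^ 2 * deriv x s - (deriv x s) ^ 3) * deriv x s
          - ((x s) ^ 3 - 3 * x s * (deriv x s) ^ 2)
            * (k * x s + α * (x s) ^ (2 * m) * deriv x s)) s := by
    refine ((((hx' s).pow 3).mul (hy' s)).sub ((hx' s).mul ((hy' s).pow 3))).congr_deriv ?_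
    simp only [Pi.pow_apply]
    push_cast
    linear_combination ((x s) ^ 3 - 3 * x s * (deriv x s) ^ 2) * hode s hs
  have hanti : AntitoneOn (fun s => (1/2) * k * (x s)^2 + (1/2) * (deriv x s)^2)
      (Set.Ici 0) := by
    refine antitoneOn_of_deriv_nonpos (convex_Ici 0)
      (fun s hs => (hE s hs).continuousAt.continuousWithinAt)
      (fun s hs => (hE s (interior_subset hs)).differentiableAt.differentiableWithinAt)
      (fun s hs => ?_)
    rw [(hE s (interior_subset hs)).deriv, neg_nonpos]
    exact mul_nonneg (mul_nonneg hα.le (hpow _)) (sq_nonneg _)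
  have hmem (s : ℝ) (hs : s ∈ Set.Icc 0 t) : (x s, deriv x s) ∈ K :=
    ⟨hlt.trans (hanti hs.1 ht0 hs.2), (hanti Set.self_mem_Ici hs.1 hs.1).trans hinit⟩
  have hW (s : ℝ) (hs : s ∈ Set.Icc 0 t) :=
    ((hE s hs.1).const_mul (n : ℝ)).add (hG s hs.1)
  have hdecay := (convex_Icc 0 t).image_sub_le_mul_sub_of_deriv_le (C := -δ)
    (fun s hs => (hW s hs).continuousAt.continuousWithinAt)
    (fun s hs => (hW s (interior_subset hs)).differentiableAt.differentiableWithinAt)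
    (fun s hs => by
      rw [(hW s (interior_subset hs)).deriv]
      have := hn _ (hmem s (interior_subset hs))
      simp only at this
      linarith)
    0 (Set.left_mem_Icc.mpr ht0) t (Set.right_mem_Icc.mpr ht0) ht0
  have h0 := (abs_le.mp (hM _ (hmem 0 (Set.left_mem_Icc.mpr ht0)))).2
  have h1 := (abs_le.mp (hM _ (hmem t (Set.right_mem_Icc.mpr ht0)))).1
  have hT : 2 * |M| < δ * t := by
    have : 2 * |M| / δ < t := by linarith
    rwa [div_lt_iff₀' hδ] at this
  simp only [Pi.add_apply] at hdecay h0 h1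
  linarith [le_abs_self M]
end

section
/- Triviality of the LaSalle invariant set for the degenerately damped oscillator: let k > 0, α > 0, let m ≥ 1 be an integer, and let I ⊆ ℝ be a nonempty open interval. If x : I → ℝ is twice continuously differentiable, satisfies x''(t) + k x(t) + α x(t)^(2m) x'(t) = 0 for all t ∈ I, and additionally x(t)^(2m) x'(t)² = 0 for all t ∈ I, then x(t) = 0 for all t ∈ I. -/
open Set

/-- Triviality of the LaSalle invariant set for the degenerately damped oscillator:
any solution on a nonempty open interval along which `x^(2m) (x')² ≡ 0` is identically
zero. -/
theorem lasalle_invariant_set_trivial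
    (k α : ℝ) (hk : 0 < k) (hα : 0 < α) (m : ℕ) (hm : 1 ≤ m)
    (I : Set ℝ) (hI : IsOpen I) (hconn : I.OrdConnected) (hne : I.Nonempty)
    (x : ℝ → ℝ) (hx : ContDiffOn ℝ 2 x I)
    (hode : ∀ t ∈ I,
      deriv (deriv x) t + k * x t + α * (x t) ^ (2*m) * deriv x t = 0)
    (hinv : ∀ t ∈ I, (x t) ^ (2*m) * (deriv x t)^2 = 0) :
    ∀ t ∈ I, x t = 0 := by
  intro t ht
  by_contra hxt
  have hcont : ContinuousAt x t := hx.continuousOn.continuousAt (hI.mem_nhds ht)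
  have hderiv : deriv x =ᶠ[nhds t] fun _ => 0 := by
    filter_upwards [hcont.eventually_ne hxt, hI.mem_nhds ht] with s hs hsI
    exact pow_eq_zero_iff two_ne_zero |>.mp
      ((mul_eq_zero.mp (hinv s hsI)).resolve_left (pow_ne_zero _ hs))
  have hderiv2 : deriv (deriv x) t = 0 := by
    rw [hderiv.deriv_eq, deriv_const]
  have hkx := hode t ht
  rw [hderiv2, hderiv.eq_of_nhds, mul_zero, add_zero, zero_add] at hkx
  exact mul_ne_zero hk.ne' hxt hkx
end
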